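/- Let Θ be a suitable set of moduli of continuity and let E be a set of weak Θ-Carathéodory functions f : ℝ × ℝ^N → ℝ^M admitting L¹_loc-equicontinuous m-bounds, with the chosen m-bounds satisfying m_f^j(t) ≤ m_f^{j+1}(t) for a.e. t ∈ ℝ for every f ∈ E and j ∈ ℕ. Then the σ_Θ-sequential closure of E admits L¹_loc-equicontinuous m-bounds: for each j ∈ ℕ one can assign to every weak Θ-Carathéodory function g that is a σ_Θ-limit of a sequence from E a locally integrable m_g^j : ℝ → [0,∞) which is an m-bound on B_j of some weak Θ-Carathéodory function g* equal to g almost everywhere on ℝ^{1+N} (in particular |g(t,x)| ≤ m_g^j(t) for a.e. t ∈ ℝ and a.e. x ∈ B_j), in such a way that for each j the family of all these functions m_g^j, together with the m-bounds m_f^j of the elements of E, is L¹_loc-equicontinuous. -/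

import Mathlib

open MeasureTheory Set Filter Topology
open scoped RealInnerProductSpace

noncomputable section

abbrev Euc (n : ℕ) := EuclideanSpace ℝ (Fin n)

/-- A function `ℝ → ℝ` is locally integrable (w.r.t. Lebesgue measure) on every
compact interval. -/
def LocInt (m : ℝ → ℝ) : Prop := ∀ a b : ℝ, IntegrableOn m (Icc a b)

section Defs

variable {N : ℕ} {F : Type*} [NormedAddCommGroup F] [NormedSpace ℝ F]

/-- The Carathéodory conditions (C1) and (C2). -/
def IsCara (f : ℝ → Euc N → F) : Prop :=
  StronglyMeasurable (Function.uncurry f) ∧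
  ∀ K : Set (Euc N), IsCompact K → ∃ m : ℝ → ℝ, (∀ t, 0 ≤ m t) ∧ LocInt m ∧
    ∀ᵐ t : ℝ, ∀ x ∈ K, ‖f t x‖ ≤ m t

/-- A suitable set of moduli of continuity `Θ = {θ_j^{[q₁,q₂]}}`. -/
structure SuitableModuli where
  θ : ℕ → ℚ → ℚ → ℝ → ℝ
  nonneg : ∀ j q₁ q₂ s, (0:ℝ) ≤ s → 0 ≤ θ j q₁ q₂ s
  cont : ∀ j q₁ q₂, ContinuousOn (θ j q₁ q₂) (Ici 0)
  mono : ∀ j q₁ q₂, MonotoneOn (θ j q₁ q₂) (Ici 0)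
  zero : ∀ j q₁ q₂, θ j q₁ q₂ 0 = 0
  ordered : ∀ j₁ j₂ q₁ q₂ p₁ p₂, j₁ ≤ j₂ → p₁ ≤ q₁ → q₂ ≤ p₂ →
    ∀ s : ℝ, 0 ≤ s → θ j₁ q₁ q₂ s ≤ θ j₂ p₁ p₂ s

/-- `x ∈ K_j^{[q₁,q₂]}`: continuous, bounded by `j` and with modulus of continuity
`θ_j^{[q₁,q₂]}` on `[q₁,q₂]`. -/
def inK {N : ℕ} (Θ : SuitableModuli) (j : ℕ) (q₁ q₂ : ℚ) (x : ℝ → Euc N) : Prop :=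
  ContinuousOn x (Icc (q₁:ℝ) (q₂:ℝ)) ∧
  (∀ t ∈ Icc (q₁:ℝ) (q₂:ℝ), ‖x t‖ ≤ (j:ℝ)) ∧
  ∀ t ∈ Icc (q₁:ℝ) (q₂:ℝ), ∀ s ∈ Icc (q₁:ℝ) (q₂:ℝ), ‖x t - x s‖ ≤ Θ.θ j q₁ q₂ |t - s|

/-- Weak Θ-Carathéodory functions: Carathéodory conditions plus condition (W). -/
def IsWTC (Θ : SuitableModuli) (f : ℝ → Euc N → F) : Prop :=
  IsCara f ∧
  ∀ (j : ℕ) (q₁ q₂ : ℚ) (xs : ℕ → ℝ → Euc N) (x : ℝ → Euc N),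
    (∀ n, inK Θ j q₁ q₂ (xs n)) → inK Θ j q₁ q₂ x →
    TendstoUniformlyOn (fun n t => xs n t) x atTop (Icc (q₁:ℝ) (q₂:ℝ)) →
    Tendsto (fun n => ∫ t in Icc (q₁:ℝ) (q₂:ℝ), f t (xs n t)) atTop
      (𝓝 (∫ t in Icc (q₁:ℝ) (q₂:ℝ), f t (x t)))

/-- Convergence in the `σ_Θ` sense:
`sup_{x ∈ K_j^I} ‖∫_I (f_n(t,x(t)) − f(t,x(t))) dt‖ → 0` for every `j` and `I`. -/
def SigmaTendsto (Θ : SuitableModuli) (fs : ℕ → ℝ → Euc N → F) (f : ℝ → Euc N → F) : Prop :=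
  ∀ (j : ℕ) (q₁ q₂ : ℚ), ∀ ε > (0:ℝ), ∀ᶠ n in atTop, ∀ x : ℝ → Euc N, inK Θ j q₁ q₂ x →
    ‖∫ t in Icc (q₁:ℝ) (q₂:ℝ), (fs n t (x t) - f t (x t))‖ < ε

end Defs

/-- Lipschitz Carathéodory functions. -/
def IsLC {N : ℕ} (f : ℝ → Euc N → Euc N) : Prop :=
  IsCara f ∧
  ∀ K : Set (Euc N), IsCompact K → ∃ l : ℝ → ℝ, LocInt l ∧
    ∀ᵐ t : ℝ, ∀ x ∈ K, ∀ y ∈ K, ‖f t x - f t y‖ ≤ l t * ‖x - y‖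

/-- The optimal m-bound of `f` on the closed ball `B_j`. -/
def mOpt {N : ℕ} (f : ℝ → Euc N → Euc N) (j : ℕ) (t : ℝ) : ℝ :=
  sSup {v : ℝ | ∃ x : Euc N, ‖x‖ ≤ (j:ℝ) ∧ v = ‖f t x‖}

/-- The time translation `f_r(s,x) = f(s+r,x)`. -/
def timeTranslate {N : ℕ} (f : ℝ → Euc N → Euc N) (r : ℝ) : ℝ → Euc N → Euc N :=
  fun s x => f (s + r) x

/-- `x` is a solution of `ẋ = g(t,x)`, `x(0) = x₀`, defined on `[0,∞)`. -/
def IsSolOn {N : ℕ} (g : ℝ → Euc N → Euc N) (x₀ : Euc N) (x : ℝ → Euc N) : Prop :=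
  ContinuousOn x (Ici 0) ∧ ∀ t ∈ Ici (0:ℝ), x t = x₀ + ∫ s in (0:ℝ)..t, g s (x s)

section Partition

/-- The `i`-th point of the partition of `[a, b]` into `l + 1` pieces of equal length. -/
def partPt (a b : ℝ) (l i : ℕ) : ℝ := a + i * ((b - a) / (l + 1))

/-- The index of the piece of the partition of `[a, b]` containing `t`. -/
def partIdx (a b : ℝ) (l : ℕ) (t : ℝ) : ℕ := ⌊(t - a) / ((b - a) / (l + 1))⌋₊

variable {a b : ℝ}

lemma mesh_pos (hab : a < b) (l : ℕ) : 0 < (b - a) / ((l : ℝ) + 1) :=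
  div_pos (sub_pos.2 hab) (by positivity)

lemma partPt_zero (l : ℕ) : partPt a b l 0 = a := by simp [partPt]

lemma partPt_last (l : ℕ) : partPt a b l (l + 1) = b := by
  have : (l : ℝ) + 1 ≠ 0 := by positivity
  simp only [partPt, Nat.cast_add, Nat.cast_one]
  field_simp
  ring

lemma partPt_succ (l i : ℕ) :
    partPt a b l (i + 1) = partPt a b l i + (b - a) / (l + 1) := by
  simp only [partPt, Nat.cast_add, Nat.cast_one]
  ring

lemma partPt_mono (hab : a < b) (l : ℕ) : Monotone (partPt a b l) :=
  monotone_nat_of_le_succ fun i => by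
    rw [partPt_succ]
    exact le_add_of_nonneg_right (mesh_pos hab l).le

lemma left_le_partPt (hab : a < b) (l i : ℕ) : a ≤ partPt a b l i := by
  simpa [partPt_zero] using partPt_mono hab l (Nat.zero_le i)

lemma partPt_le_right (hab : a < b) {l i : ℕ} (hi : i ≤ l + 1) : partPt a b l i ≤ b := by
  simpa [partPt_last] using partPt_mono hab l hi

lemma mem_Ico_partIdx (hab : a < b) (l : ℕ) {t : ℝ} (ht : a ≤ t) :
    t ∈ Ico (partPt a b l (partIdx a b l t)) (partPt a b l (partIdx a b l t + 1)) := by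
  have hd := mesh_pos hab l
  have h0 : 0 ≤ (t - a) / ((b - a) / (l + 1)) := div_nonneg (sub_nonneg.2 ht) hd.le
  have h1 := Nat.floor_le h0
  have h2 := Nat.lt_floor_add_one ((t - a) / ((b - a) / (l + 1)))
  rw [le_div_iff₀ hd] at h1
  rw [div_lt_iff₀ hd] at h2
  simp only [partPt, partIdx, mem_Ico, Nat.cast_add, Nat.cast_one]
  constructor <;> linarith

lemma partIdx_le (hab : a < b) (l : ℕ) {t : ℝ} (ht : t ∈ Ico a b) : partIdx a b l t ≤ l := by
  by_contra! h
  have h1 := partPt_mono hab l (Nat.succ_le_of_lt h)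
  rw [Nat.succ_eq_add_one, partPt_last] at h1
  exact absurd (mem_Ico_partIdx hab l ht.1).1 (not_le.2 (ht.2.trans_le h1))

lemma partIdx_eq (hab : a < b) {l i : ℕ} {t : ℝ}
    (ht : t ∈ Ico (partPt a b l i) (partPt a b l (i + 1))) : partIdx a b l t = i := by
  have h := mem_Ico_partIdx hab l ((left_le_partPt hab l i).trans ht.1)
  have h1 : i < partIdx a b l t + 1 :=
    (partPt_mono hab l).reflect_lt (ht.1.trans_lt h.2)
  have h2 : partIdx a b l t < i + 1 :=
    (partPt_mono hab l).reflect_lt (h.1.trans_lt ht.2)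
  omega

/-- The piece of the partition of `[a, b]` containing `t`, as a closed interval. -/
def partPiece (a b : ℝ) (l : ℕ) (t : ℝ) : Set ℝ :=
  Icc (partPt a b l (partIdx a b l t)) (partPt a b l (partIdx a b l t + 1))

lemma partPiece_subset (hab : a < b) (l : ℕ) {t : ℝ} (ht : t ∈ Ico a b) :
    partPiece a b l t ⊆ Icc a b :=
  Icc_subset_Icc (left_le_partPt hab _ _)
    (partPt_le_right hab (Nat.succ_le_succ (partIdx_le hab l ht)))

lemma mem_partPiece (hab : a < b) (l : ℕ) {t : ℝ} (ht : a ≤ t) : t ∈ partPiece a b l t :=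
  Ico_subset_Icc_self (mem_Ico_partIdx hab l ht)

lemma tendsto_mesh : Tendsto (fun l : ℕ => (b - a) / ((l : ℝ) + 1)) atTop (𝓝 0) := by
  simpa [div_eq_mul_inv] using
    (tendsto_one_div_add_atTop_nhds_zero_nat (𝕜 := ℝ)).const_mul (b - a)

lemma eventually_partPiece_subset (hab : a < b) {t : ℝ} (ht : t ∈ Ico a b) {u : Set ℝ}
    (hu : u ∈ 𝓝 t) : ∀ᶠ l : ℕ in atTop, partPiece a b l t ⊆ u := by
  obtain ⟨ε, hε, hεu⟩ := Metric.mem_nhds_iff.1 hu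
  filter_upwards [(tendsto_order.1 (tendsto_mesh (a := a) (b := b))).2 ε hε] with l hl s hs
  apply hεu
  have h1 := mem_partPiece hab l ht.1
  simp only [partPiece, partPt_succ, mem_Icc] at h1 hs
  rw [Metric.mem_ball, Real.dist_eq, abs_lt]
  constructor <;> linarith [h1.1, h1.2, hs.1, hs.2]

/-- Lebesgue differentiation along the equal-length partitions of an interval. -/
lemma ae_tendsto_average_partPiece {E : Type*} [NormedAddCommGroup E] [NormedSpace ℝ E]
    [CompleteSpace E] (hab : a < b) {h : ℝ → E} (hh : IntegrableOn h (Icc a b)) :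
    ∀ᵐ t : ℝ, t ∈ Ico a b → Tendsto (fun l : ℕ =>
      ((b - a) / ((l : ℝ) + 1))⁻¹ • ∫ u in partPiece a b l t, h u) atTop (𝓝 (h t)) := by
  have hI : Integrable ((Icc a b).indicator h) := hh.integrable_indicator measurableSet_Icc
  filter_upwards [IsUnifLocDoublingMeasure.ae_tendsto_average volume hI.locallyIntegrable 1]
    with t ht htab
  have hmesh : Tendsto (fun l : ℕ => (b - a) / ((l : ℝ) + 1) / 2) atTop (𝓝[>] 0) := by
    refine tendsto_nhdsWithin_iff.2 ⟨?_, Eventually.of_forall fun l => half_pos (mesh_pos hab l)⟩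
    simpa using (tendsto_mesh (a := a) (b := b)).div_const 2
  have hball : ∀ l : ℕ, Metric.closedBall
      (partPt a b l (partIdx a b l t) + (b - a) / ((l : ℝ) + 1) / 2)
      ((b - a) / ((l : ℝ) + 1) / 2) = partPiece a b l t := fun l => by
    rw [Real.closedBall_eq_Icc, partPiece, partPt_succ]
    congr 1 <;> ring
  have key := ht (fun l : ℕ => partPt a b l (partIdx a b l t) + (b - a) / ((l : ℝ) + 1) / 2) _
    hmesh (Eventually.of_forall fun l => by
      rw [one_mul, hball]; exact mem_partPiece hab l htab.1)
  rw [indicator_of_mem (Ico_subset_Icc_self htab)] at key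
  refine key.congr fun l => ?_
  rw [hball, setAverage_eq]
  congr 1
  · rw [partPiece, Measure.real, Real.volume_Icc, partPt_succ, add_sub_cancel_left,
      ENNReal.toReal_ofReal (mesh_pos hab l).le]
  · refine setIntegral_congr_fun measurableSet_Icc fun u hu => ?_
    exact indicator_of_mem (partPiece_subset hab l htab hu) _

/-- If the integrals of `h` over all small partition pieces around `t` are dominated by those
of `m`, then so is `h` at almost every such `t`. -/
lemma ae_norm_le_of_eventually_integral_le {E : Type*} [NormedAddCommGroup E] [NormedSpace ℝ E]
    [CompleteSpace E] (hab : a < b) {h : ℝ → E} {m : ℝ → ℝ} (hh : IntegrableOn h (Icc a b))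
    (hm : IntegrableOn m (Icc a b)) :
    ∀ᵐ t : ℝ, t ∈ Ico a b →
      (∀ᶠ l : ℕ in atTop, ‖∫ u in partPiece a b l t, h u‖ ≤ ∫ u in partPiece a b l t, m u) →
      ‖h t‖ ≤ m t := by
  filter_upwards [ae_tendsto_average_partPiece hab hh, ae_tendsto_average_partPiece hab hm]
    with t h1 h2 ht hle
  refine le_of_tendsto_of_tendsto (h1 ht).norm (h2 ht) ?_
  filter_upwards [hle] with l hl
  have := inv_nonneg.2 (mesh_pos hab l).le
  rw [norm_smul, Real.norm_of_nonneg this, smul_eq_mul]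
  exact mul_le_mul_of_nonneg_left hl this

lemma Ico_subset_iUnion_partPt (hab : a < b) (l : ℕ) : Ico a b ⊆
    ⋃ i ∈ Finset.range (l + 1), Ico (partPt a b l i) (partPt a b l (i + 1)) := fun t ht =>
  mem_biUnion (by simpa using Nat.lt_succ_of_le (partIdx_le hab l ht)) (mem_Ico_partIdx hab l ht.1)

/-- If the integrals of all members of a countable family over the partition pieces are dominated
by constants summing up to `C`, then the integral of the supremum of the norms is at most `C`. -/
lemma lintegral_iSup_enorm_le {E ι : Type*} [NormedAddCommGroup E] [NormedSpace ℝ E]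
    [CompleteSpace E] [Countable ι] (hab : a < b) {h : ι → ℝ → E}
    (hh : ∀ k, IntegrableOn (h k) (Icc a b)) {C : ℝ} (c : ℕ → ℕ → ℝ) (hc : ∀ l i, 0 ≤ c l i)
    (hle : ∀ l i, i ≤ l → ∀ k, ‖∫ u in Icc (partPt a b l i) (partPt a b l (i + 1)), h k u‖ ≤ c l i)
    (hsum : ∀ l, ∑ i ∈ Finset.range (l + 1), c l i ≤ C) :
    ∫⁻ t in Ico a b, ⨆ k, ‖h k t‖ₑ ≤ ENNReal.ofReal C := by
  set ψ : ℕ → ℝ → ENNReal := fun l t =>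
    ENNReal.ofReal (((b - a) / ((l : ℝ) + 1))⁻¹ * c l (partIdx a b l t)) with hψ
  have hmeas : ∀ l, Measurable (ψ l) := fun l => by
    have h1 : Measurable (partIdx a b l) :=
      Nat.measurable_floor.comp ((measurable_id.sub_const a).div_const _)
    have h2 : Measurable (c l) := measurable_from_top
    exact ((h2.comp h1).const_mul _).ennreal_ofReal
  have hbound : ∀ᵐ t ∂(volume.restrict (Ico a b)),
      ⨆ k, ‖h k t‖ₑ ≤ liminf (fun l => ψ l t) atTop := by
    rw [ae_restrict_iff' measurableSet_Ico]
    filter_upwards [ae_all_iff.2 fun k => ae_tendsto_average_partPiece hab (hh k)] with t ht htab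
    refine iSup_le fun k => ?_
    rw [← (ht k htab).enorm.liminf_eq]
    refine liminf_le_liminf (Eventually.of_forall fun l => ?_)
    have := inv_nonneg.2 (mesh_pos hab l).le
    rw [← ofReal_norm, norm_smul, Real.norm_of_nonneg this]
    exact ENNReal.ofReal_le_ofReal
      (mul_le_mul_of_nonneg_left (hle l _ (partIdx_le hab l htab) k) this)
  have hint : ∀ l, ∫⁻ t in Ico a b, ψ l t ≤ ENNReal.ofReal C := fun l => by
    calc ∫⁻ t in Ico a b, ψ l t
        ≤ ∫⁻ t in ⋃ i ∈ Finset.range (l + 1), Ico (partPt a b l i) (partPt a b l (i + 1)), ψ l t :=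
          lintegral_mono_set (Ico_subset_iUnion_partPt hab l)
      _ = ∑ i ∈ Finset.range (l + 1),
            ∫⁻ t in Ico (partPt a b l i) (partPt a b l (i + 1)), ψ l t :=
          lintegral_biUnion_finset
            ((partPt_mono hab l).pairwise_disjoint_on_Ico_succ.set_pairwise _)
            (fun _ _ => measurableSet_Ico) _
      _ = ∑ i ∈ Finset.range (l + 1), ENNReal.ofReal (c l i) := by
          refine Finset.sum_congr rfl fun i _ => ?_
          have hd := mesh_pos hab l
          rw [setLIntegral_congr_fun (g := fun _ =>
            ENNReal.ofReal (((b - a) / ((l : ℝ) + 1))⁻¹ * c l i)) measurableSet_Ico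
            (fun t ht => by simp only [hψ, partIdx_eq hab ht]), setLIntegral_const,
            Real.volume_Ico, partPt_succ, add_sub_cancel_left, ← ENNReal.ofReal_mul
              (mul_nonneg (inv_nonneg.2 hd.le) (hc l i))]
          rw [mul_right_comm, inv_mul_cancel₀ hd.ne', one_mul]
      _ = ENNReal.ofReal (∑ i ∈ Finset.range (l + 1), c l i) :=
          (ENNReal.ofReal_sum_of_nonneg fun i _ => hc l i).symm
      _ ≤ ENNReal.ofReal C := ENNReal.ofReal_le_ofReal (hsum l)
  calc ∫⁻ t in Ico a b, ⨆ k, ‖h k t‖ₑ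
      ≤ ∫⁻ t in Ico a b, liminf (fun l => ψ l t) atTop := lintegral_mono_ae hbound
    _ ≤ liminf (fun l => ∫⁻ t in Ico a b, ψ l t) atTop := lintegral_liminf_le hmeas
    _ ≤ ENNReal.ofReal C := by
      refine (liminf_le_liminf (Eventually.of_forall hint)).trans_eq ?_
      exact tendsto_const_nhds.liminf_eq

end Partition

section WeakCaratheodory

variable {N : ℕ} {F : Type*} [NormedAddCommGroup F] {g : ℝ → Euc N → F}

lemma IsCara.integrableOn_comp (hg : IsCara g) {a b : ℝ} {x : ℝ → Euc N}
    (hx : ContinuousOn x (Icc a b)) : IntegrableOn (fun t => g t (x t)) (Icc a b) := by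
  obtain ⟨m, -, hm, hgm⟩ := hg.2 _ (isCompact_Icc.image_of_continuousOn hx)
  refine (hm a b).mono' ?_ ?_
  · exact hg.1.aestronglyMeasurable.comp_aemeasurable
      (aemeasurable_id.prodMk (hx.aemeasurable measurableSet_Icc))
  · rw [ae_restrict_iff' measurableSet_Icc]
    filter_upwards [hgm] with t ht hta
    exact ht _ (mem_image_of_mem x hta)

/-- The supremum of `‖g t x‖` over a countable dense set of points `x` of the open ball of
radius `j + 1`. -/
def ballSup (g : ℝ → Euc N → F) (j : ℕ) (t : ℝ) : ENNReal :=
  ⨆ k : {k : ℕ // ‖TopologicalSpace.denseSeq (Euc N) k‖ < (j : ℝ) + 1},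
    ‖g t (TopologicalSpace.denseSeq (Euc N) k)‖ₑ

lemma IsCara.measurable_ballSup (hg : IsCara g) (j : ℕ) : Measurable (ballSup g j) :=
  Measurable.iSup fun k => (hg.1.comp_measurable
    (measurable_id.prodMk measurable_const : Measurable fun t : ℝ =>
      (t, TopologicalSpace.denseSeq (Euc N) k))).enorm

lemma IsCara.exists_ballSup_le (hg : IsCara g) (j : ℕ) : ∃ m : ℝ → ℝ, (∀ t, 0 ≤ m t) ∧
    LocInt m ∧ ∀ᵐ t : ℝ, ballSup g j t ≤ ENNReal.ofReal (m t) := by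
  obtain ⟨m, h0, hm, hgm⟩ := hg.2 _ (isCompact_closedBall (0 : Euc N) (j + 1))
  refine ⟨m, h0, hm, ?_⟩
  filter_upwards [hgm] with t ht
  refine iSup_le fun k => ?_
  rw [← ofReal_norm]
  exact ENNReal.ofReal_le_ofReal (ht _ (mem_closedBall_zero_iff.2 k.2.le))

lemma IsCara.ae_ballSup_lt_top (hg : IsCara g) (j : ℕ) : ∀ᵐ t : ℝ, ballSup g j t < ⊤ := by
  obtain ⟨m, -, -, hm⟩ := hg.exists_ballSup_le j
  filter_upwards [hm] with t ht using ht.trans_lt ENNReal.ofReal_lt_top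

lemma IsCara.locInt_ballSup (hg : IsCara g) (j : ℕ) : LocInt fun t => (ballSup g j t).toReal := by
  obtain ⟨m, h0, hmi, hm⟩ := hg.exists_ballSup_le j
  intro a b
  refine (hmi a b).mono' (hg.measurable_ballSup j).ennreal_toReal.aestronglyMeasurable ?_
  filter_upwards [ae_restrict_of_ae hm] with t ht
  rw [Real.norm_of_nonneg ENNReal.toReal_nonneg]
  exact ENNReal.toReal_le_of_le_ofReal (h0 t) ht

lemma IsCara.measurableSet_norm_le_ballSup (hg : IsCara g) (j : ℕ) (R : ℝ) :
    MeasurableSet {p : ℝ × Euc N | ‖p.2‖ < R → ‖g p.1 p.2‖ ≤ (ballSup g j p.1).toReal} := by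
  have h1 : MeasurableSet {p : ℝ × Euc N | ‖p.2‖ < R} :=
    measurableSet_lt measurable_snd.norm measurable_const
  have h2 : MeasurableSet {p : ℝ × Euc N | ‖g p.1 p.2‖ ≤ (ballSup g j p.1).toReal} :=
    measurableSet_le hg.1.norm.measurable
      ((hg.measurable_ballSup j).ennreal_toReal.comp measurable_fst)
  exact h1.himp h2

variable [NormedSpace ℝ F] {Θ : SuitableModuli}

lemma inK_const {j : ℕ} {c : Euc N} (hc : ‖c‖ ≤ j) (q₁ q₂ : ℚ) :
    inK Θ j q₁ q₂ (fun _ => c) :=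
  ⟨continuousOn_const, fun _ _ => hc, fun t _ s _ => by
    simpa using Θ.nonneg j q₁ q₂ |t - s| (abs_nonneg _)⟩

lemma inK.comp_clamp {j : ℕ} {a b p q : ℚ} {x : ℝ → Euc N} (hx : inK Θ j a b x)
    (hap : a ≤ p) (hpq : p ≤ q) (hqb : q ≤ b) :
    inK Θ j a b (fun t => x (max (p : ℝ) (min t q))) := by
  have hap' : (a : ℝ) ≤ p := by exact_mod_cast hap
  have hpq' : (p : ℝ) ≤ q := by exact_mod_cast hpq
  have hqb' : (q : ℝ) ≤ b := by exact_mod_cast hqb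
  have hmem : ∀ t : ℝ, max (p : ℝ) (min t q) ∈ Icc (a : ℝ) b := fun t =>
    ⟨hap'.trans (le_max_left _ _), (max_le hpq' (min_le_right _ _)).trans hqb'⟩
  refine ⟨?_, fun t _ => hx.2.1 _ (hmem t), fun t _ s _ => ?_⟩
  · exact hx.1.comp (by fun_prop) fun t _ => hmem t
  · refine (hx.2.2 _ (hmem t) _ (hmem s)).trans
      (Θ.mono j a b (mem_Ici.2 (abs_nonneg _)) (mem_Ici.2 (abs_nonneg _)) ?_)
    calc |max (p : ℝ) (min t q) - max (p : ℝ) (min s q)|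
        ≤ |min t (q : ℝ) - min s q| := by
          simpa [max_comm] using abs_max_sub_max_le_abs (min t (q : ℝ)) (min s q) p
      _ ≤ |t - s| := by
          simpa using abs_min_sub_min_le_max t (q : ℝ) s q

/-- Integrals of a weak Carathéodory function along a convergent sequence of curves also converge
on rational subintervals. -/
lemma IsWTC.tendsto_integral_subinterval (hg : IsWTC Θ g) {j : ℕ} {a b p q : ℚ}
    {xs : ℕ → ℝ → Euc N} {x : ℝ → Euc N} (hxs : ∀ n, inK Θ j a b (xs n)) (hx : inK Θ j a b x)
    (hlim : TendstoUniformlyOn (fun n t => xs n t) x atTop (Icc (a : ℝ) b))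
    (hap : a ≤ p) (hpq : p ≤ q) (hqb : q ≤ b) :
    Tendsto (fun n => ∫ t in Icc (p : ℝ) q, g t (xs n t)) atTop
      (𝓝 (∫ t in Icc (p : ℝ) q, g t (x t))) := by
  have hap' : (a : ℝ) ≤ p := by exact_mod_cast hap
  have hpq' : (p : ℝ) ≤ q := by exact_mod_cast hpq
  have hqb' : (q : ℝ) ≤ b := by exact_mod_cast hqb
  have hp : (p : ℝ) ∈ Icc (a : ℝ) b := ⟨hap', hpq'.trans hqb'⟩
  have hq : (q : ℝ) ∈ Icc (a : ℝ) b := ⟨hap'.trans hpq', hqb'⟩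
  have hsplit : ∀ y : ℝ → Euc N, inK Θ j a b y → ∫ t in Icc (p : ℝ) q, g t (y t) =
      (∫ t in Icc (a : ℝ) b, g t (y (max (p : ℝ) (min t q)))) -
        (∫ t in Icc (a : ℝ) p, g t (y p)) - ∫ t in Icc (q : ℝ) b, g t (y q) := by
    intro y hy
    have hint := hg.1.integrableOn_comp (hy.comp_clamp hap hpq hqb).1
    have e1 : ∫ t in Icc (a : ℝ) p, g t (y p) =
        ∫ t in Icc (a : ℝ) p, g t (y (max (p : ℝ) (min t q))) := by
      refine setIntegral_congr_fun measurableSet_Icc fun t ht => ?_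
      simp only [min_eq_left (ht.2.trans hpq'), max_eq_left ht.2]
    have e2 : ∫ t in Icc (p : ℝ) q, g t (y t) =
        ∫ t in Icc (p : ℝ) q, g t (y (max (p : ℝ) (min t q))) := by
      refine setIntegral_congr_fun measurableSet_Icc fun t ht => ?_
      simp only [min_eq_left ht.2, max_eq_right ht.1]
    have e3 : ∫ t in Icc (q : ℝ) b, g t (y q) =
        ∫ t in Icc (q : ℝ) b, g t (y (max (p : ℝ) (min t q))) := by
      refine setIntegral_congr_fun measurableSet_Icc fun t ht => ?_
      simp only [min_eq_right ht.1, max_eq_right hpq']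
    rw [e1, e2, e3]
    have hii : ∀ {c d : ℝ}, c ∈ Icc (a : ℝ) b → d ∈ Icc (a : ℝ) b → IntervalIntegrable
        (fun t => g t (y (max (p : ℝ) (min t q)))) volume c d := fun hc hd =>
      (hint.mono_set (ordConnected_Icc.uIcc_subset hc hd)).intervalIntegrable
    have ha : (a : ℝ) ∈ Icc (a : ℝ) b := ⟨le_rfl, hp.1.trans hp.2⟩
    have hb : (b : ℝ) ∈ Icc (a : ℝ) b := ⟨hp.1.trans hp.2, le_rfl⟩
    simp only [integral_Icc_eq_integral_Ioc]
    rw [← intervalIntegral.integral_of_le hap', ← intervalIntegral.integral_of_le hpq',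
      ← intervalIntegral.integral_of_le hqb', ← intervalIntegral.integral_of_le ha.2,
      ← intervalIntegral.integral_add_adjacent_intervals (hii ha hp) (hii hp hb),
      ← intervalIntegral.integral_add_adjacent_intervals (hii hp hq) (hii hq hb)]
    abel
  have hconst : ∀ {c : ℝ}, c ∈ Icc (a : ℝ) b → ∀ r₁ r₂ : ℚ,
      Tendsto (fun n => ∫ t in Icc (r₁ : ℝ) r₂, g t (xs n c)) atTop
        (𝓝 (∫ t in Icc (r₁ : ℝ) r₂, g t (x c))) := fun {c} hc r₁ r₂ =>
    hg.2 j r₁ r₂ (fun n _ => xs n c) (fun _ => x c) (fun n => inK_const ((hxs n).2.1 c hc) _ _)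
      (inK_const (hx.2.1 c hc) _ _) (by
        rw [Metric.tendstoUniformlyOn_iff] at hlim ⊢
        intro ε hε
        filter_upwards [hlim ε hε] with n hn _ _ using hn c hc)
  rw [hsplit x hx]
  simp only [fun n => hsplit (xs n) (hxs n)]
  refine Tendsto.sub (Tendsto.sub ?_ (hconst hp a p)) (hconst hq q b)
  refine hg.2 j a b _ _ (fun n => (hxs n).comp_clamp hap hpq hqb) (hx.comp_clamp hap hpq hqb) ?_
  rw [Metric.tendstoUniformlyOn_iff] at hlim ⊢
  intro ε hε
  filter_upwards [hlim ε hε] with n hn t _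
  exact hn _ ⟨hap'.trans (le_max_left _ _), (max_le hpq' (min_le_right _ _)).trans hqb'⟩

/-- A pointwise bound along a sequence of curves in an open ball passes to the limit curve. -/
lemma IsWTC.ae_norm_le_of_tendstoUniformlyOn [CompleteSpace F] (hg : IsWTC Θ g) {j : ℕ} {a b : ℚ}
    {xs : ℕ → ℝ → Euc N} {x : ℝ → Euc N} (hxs : ∀ n, inK Θ j a b (xs n)) (hx : inK Θ j a b x)
    (hlim : TendstoUniformlyOn (fun n t => xs n t) x atTop (Icc (a : ℝ) b))
    {m : ℝ → ℝ} (hm : IntegrableOn m (Icc (a : ℝ) b)) {R : ℝ}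
    (hbd : ∀ n, ∀ᵐ t : ℝ, t ∈ Icc (a : ℝ) b → ‖xs n t‖ < R → ‖g t (xs n t)‖ ≤ m t) :
    ∀ᵐ t : ℝ, t ∈ Icc (a : ℝ) b → ‖x t‖ < R → ‖g t (x t)‖ ≤ m t := by
  rcases le_or_gt b a with hba | hab
  · have hba' : (b : ℝ) ≤ a := by exact_mod_cast hba
    filter_upwards [Measure.ae_ne volume (a : ℝ)] with t ht hmem
    exact absurd (le_antisymm (hmem.2.trans hba') hmem.1) ht
  have hab' : (a : ℝ) < b := by exact_mod_cast hab
  filter_upwards [ae_norm_le_of_eventually_integral_le hab' (hg.1.integrableOn_comp hx.1) hm,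
    Measure.ae_ne volume (b : ℝ)] with t ht htb hmem hR
  have htI : t ∈ Ico (a : ℝ) b := ⟨hmem.1, lt_of_le_of_ne hmem.2 htb⟩
  refine ht htI ?_
  obtain ⟨R', hR', hR'R⟩ := exists_between hR
  have hnhds : {s | ‖x s‖ < R'} ∈ 𝓝[Icc (a : ℝ) b] t :=
    (hx.1 t hmem).norm.eventually (gt_mem_nhds hR')
  obtain ⟨v, hv, hvx⟩ := mem_nhdsWithin_iff_exists_mem_nhds_inter.1 hnhds
  filter_upwards [eventually_partPiece_subset hab' htI hv] with l hl
  have hsub := partPiece_subset hab' l htI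
  have hpt : ∀ i : ℕ, ((a + i * ((b - a) / (l + 1)) : ℚ) : ℝ) = partPt a b l i := fun i => by
    simp [partPt]
  have hi := partIdx_le hab' l htI
  have hle : ∀ i : ℕ, partPt a b l i ≤ partPt a b l (i + 1) := fun i =>
    partPt_mono hab' l i.le_succ
  have hconv := hg.tendsto_integral_subinterval (p := a + (partIdx a b l t : ℕ) * ((b - a) / (l + 1)))
    (q := a + (partIdx a b l t + 1 : ℕ) * ((b - a) / (l + 1))) hxs hx hlim
    (by rw [← Rat.cast_le (K := ℝ), hpt]; exact left_le_partPt hab' _ _)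
    (by rw [← Rat.cast_le (K := ℝ), hpt, hpt]; exact hle _)
    (by rw [← Rat.cast_le (K := ℝ), hpt]; exact partPt_le_right hab' (Nat.succ_le_succ hi))
  rw [hpt, hpt] at hconv
  refine le_of_tendsto hconv.norm ?_
  filter_upwards [Metric.tendstoUniformlyOn_iff.1 hlim (R - R') (sub_pos.2 hR'R)] with n hn
  refine norm_integral_le_of_norm_le (hm.mono_set hsub) ?_
  refine (ae_restrict_iff' measurableSet_Icc).2 ?_
  filter_upwards [hbd n] with s hs hsJ
  refine hs (hsub hsJ) ?_
  have h1 : ‖x s‖ < R' := hvx ⟨hl hsJ, hsub hsJ⟩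
  have h2 := hn s (hsub hsJ)
  rw [dist_comm, dist_eq_norm] at h2
  linarith [norm_sub_norm_le (xs n s) (x s)]

lemma IsWTC.ae_norm_apply_le [CompleteSpace F] (hg : IsWTC Θ g) (j : ℕ) {x : Euc N}
    (hx : ‖x‖ < (j : ℝ) + 1) : ∀ᵐ t : ℝ, ‖g t x‖ ≤ (ballSup g j t).toReal := by
  obtain ⟨y, hy, hyx⟩ := mem_closure_iff_seq_limit.1
    (TopologicalSpace.denseRange_denseSeq (Euc N) x)
  obtain ⟨C, hC⟩ := (Metric.isBounded_range_of_tendsto y hyx).exists_norm_le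
  obtain ⟨j', hj'⟩ := exists_nat_ge (max C ‖x‖)
  have hlim : ∀ n : ℕ, ∀ᵐ t : ℝ, t ∈ Icc ((-n : ℚ) : ℝ) ((n : ℚ) : ℝ) → ‖x‖ < (j : ℝ) + 1 →
      ‖g t x‖ ≤ (ballSup g j t).toReal := fun n => by
    refine hg.ae_norm_le_of_tendstoUniformlyOn (j := j') (xs := fun n _ => y n) (x := fun _ => x)
      (fun n => inK_const ((hC _ (mem_range_self n)).trans ((le_max_left _ _).trans hj')) _ _)
      (inK_const ((le_max_right _ _).trans hj') _ _) ?_ (hg.1.locInt_ballSup j _ _) fun i => ?_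
    · rw [Metric.tendstoUniformlyOn_iff]
      intro ε hε
      filter_upwards [Metric.tendsto_nhds.1 hyx ε hε] with n hn _ _
      rwa [dist_comm]
    · filter_upwards [hg.1.ae_ballSup_lt_top j] with t ht _ hi
      obtain ⟨k, hk⟩ := hy i
      rw [← hk] at hi ⊢
      rw [← toReal_enorm]
      exact ENNReal.toReal_mono ht.ne (le_iSup (fun k : {k : ℕ //
        ‖TopologicalSpace.denseSeq (Euc N) k‖ < (j : ℝ) + 1} =>
          ‖g t (TopologicalSpace.denseSeq (Euc N) k)‖ₑ) ⟨k, hi⟩)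
  filter_upwards [ae_all_iff.2 hlim] with t ht
  obtain ⟨n, hn⟩ := exists_nat_ge |t|
  exact ht n (by simpa [← abs_le] using hn) hx

lemma IsWTC.ae_ae_norm_le [CompleteSpace F] (hg : IsWTC Θ g) (j : ℕ) :
    ∀ᵐ t : ℝ, ∀ᵐ x : Euc N, ‖x‖ < (j : ℝ) + 1 → ‖g t x‖ ≤ (ballSup g j t).toReal := by
  refine (Measure.ae_ae_comm (hg.1.measurableSet_norm_le_ballSup j _)).2
    (Eventually.of_forall fun x => ?_)
  by_cases hx : ‖x‖ < (j : ℝ) + 1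
  · filter_upwards [hg.ae_norm_apply_le j hx] with t ht _ using ht
  · exact Eventually.of_forall fun t h => absurd h hx

/-- The bound by the supremum over a countable dense set holds along every curve. -/
lemma IsWTC.ae_norm_comp_le [CompleteSpace F] (hg : IsWTC Θ g) (j : ℕ) {i : ℕ} {a b : ℚ}
    {x : ℝ → Euc N} (hx : inK Θ i a b x) :
    ∀ᵐ t : ℝ, t ∈ Icc (a : ℝ) b → ‖x t‖ < (j : ℝ) + 1 →
      ‖g t (x t)‖ ≤ (ballSup g j t).toReal := by
  rcases lt_or_ge b a with hba | hab
  · have hba' : (b : ℝ) < a := by exact_mod_cast hba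
    exact Eventually.of_forall fun t ht => absurd (ht.1.trans ht.2) (not_le.2 hba')
  have hab' : (a : ℝ) ≤ b := by exact_mod_cast hab
  obtain ⟨y, hy, hyx⟩ : ∃ y : ℝ → Euc N, Continuous y ∧ ∀ t ∈ Icc (a : ℝ) b, y t = x t :=
    ⟨IccExtend hab' ((Icc (a : ℝ) b).domRestrict x), (continuousOn_iff_continuous_domRestrict.1
      hx.1).Icc_extend', fun t ht => IccExtend_of_mem hab' _ ht⟩
  have hgood : ∀ᵐ c : Euc N, ∀ᵐ t : ℝ, ‖y t + c‖ < (j : ℝ) + 1 →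
      ‖g t (y t + c)‖ ≤ (ballSup g j t).toReal := by
    have hmeas : Measurable fun p : ℝ × Euc N => (p.1, y p.1 + p.2) :=
      measurable_fst.prodMk ((hy.measurable.comp measurable_fst).add measurable_snd)
    refine (Measure.ae_ae_comm (p := fun t c => ‖y t + c‖ < (j : ℝ) + 1 →
      ‖g t (y t + c)‖ ≤ (ballSup g j t).toReal)
      (hmeas (hg.1.measurableSet_norm_le_ballSup j ((j : ℝ) + 1)))).1 ?_
    filter_upwards [hg.ae_ae_norm_le j] with t ht
    exact (measurePreserving_add_left volume (y t)).quasiMeasurePreserving.ae ht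
  have hex : ∀ n : ℕ, ∃ c : Euc N, ‖c‖ < 1 / ((n : ℝ) + 1) ∧ ∀ᵐ t : ℝ,
      ‖y t + c‖ < (j : ℝ) + 1 → ‖g t (y t + c)‖ ≤ (ballSup g j t).toReal := fun n => by
    obtain ⟨c, hc, hc'⟩ := (Measure.dense_of_ae hgood).exists_mem_open
      (Metric.isOpen_ball (x := (0 : Euc N)) (ε := 1 / ((n : ℝ) + 1)))
      ⟨0, Metric.mem_ball_self (by positivity)⟩
    exact ⟨c, mem_ball_zero_iff.1 hc', hc⟩
  choose c hc hcg using hex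
  have hc1 : ∀ n, ‖c n‖ ≤ 1 := fun n => (hc n).le.trans (by
    rw [div_le_one (by positivity)]; linarith [n.cast_nonneg (α := ℝ)])
  have hmodulus : ∀ s : ℝ, Θ.θ i a b |s| ≤ Θ.θ (i + 1) a b |s| := fun s =>
    Θ.ordered i (i + 1) a b a b i.le_succ le_rfl le_rfl _ (abs_nonneg s)
  refine hg.ae_norm_le_of_tendstoUniformlyOn (j := i + 1) (xs := fun n t => x t + c n)
    (fun n => ⟨hx.1.add continuousOn_const, fun t ht => ?_, fun t ht s hs => ?_⟩)
    ⟨hx.1, fun t ht => ?_, fun t ht s hs => ?_⟩ ?_ (hg.1.locInt_ballSup j _ _) fun n => ?_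
  · push_cast
    exact (norm_add_le _ _).trans (add_le_add (hx.2.1 t ht) (hc1 n))
  · rw [add_sub_add_right_eq_sub]
    exact (hx.2.2 t ht s hs).trans (hmodulus _)
  · push_cast
    linarith [hx.2.1 t ht]
  · exact (hx.2.2 t ht s hs).trans (hmodulus _)
  · rw [Metric.tendstoUniformlyOn_iff]
    intro ε hε
    filter_upwards [(tendsto_order.1 (tendsto_one_div_add_atTop_nhds_zero_nat (𝕜 := ℝ))).2 ε hε]
      with n hn t _
    rw [dist_self_add_right]
    exact (hc n).trans hn
  · filter_upwards [hcg n] with t ht htI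
    rwa [← hyx t htI]

/-- A weak Carathéodory function agrees almost everywhere with one that is bounded on the ball of
radius `j` by the supremum over a countable dense set. -/
lemma IsWTC.exists_ae_eq_norm_le [CompleteSpace F] (hg : IsWTC Θ g) (j : ℕ) :
    ∃ gstar : ℝ → Euc N → F, IsWTC Θ gstar ∧
      (∀ᵐ p : ℝ × Euc N, gstar p.1 p.2 = g p.1 p.2) ∧
      ∀ t : ℝ, ∀ x : Euc N, ‖x‖ ≤ (j : ℝ) → ‖gstar t x‖ ≤ (ballSup g j t).toReal := by
  set S : Set (ℝ × Euc N) :=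
    {p | ‖p.2‖ < (j : ℝ) + 1 → ‖g p.1 p.2‖ ≤ (ballSup g j p.1).toReal} with hS
  have hSm : MeasurableSet S := hg.1.measurableSet_norm_le_ballSup j _
  have heq : ∀ (i : ℕ) (q₁ q₂ : ℚ) (x : ℝ → Euc N), inK Θ i q₁ q₂ x →
      ∫ t in Icc (q₁ : ℝ) q₂, S.indicator (Function.uncurry g) (t, x t) =
        ∫ t in Icc (q₁ : ℝ) q₂, g t (x t) := fun i q₁ q₂ x hx => by
    refine setIntegral_congr_ae measurableSet_Icc ?_
    filter_upwards [hg.ae_norm_comp_le j hx] with t ht htI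
    exact indicator_of_mem (show (t, x t) ∈ S from ht htI) _
  refine ⟨fun t x => S.indicator (Function.uncurry g) (t, x), ⟨⟨hg.1.1.indicator hSm, ?_⟩, ?_⟩,
    ?_, fun t x hx => ?_⟩
  · intro K hK
    obtain ⟨m, h0, hm, hgm⟩ := hg.1.2 K hK
    refine ⟨m, h0, hm, ?_⟩
    filter_upwards [hgm] with t ht x hx
    exact (norm_indicator_le_norm_self _ _).trans (ht x hx)
  · intro i q₁ q₂ xs x hxs hx hlim
    rw [heq i q₁ q₂ x hx]
    simp only [fun n => heq i q₁ q₂ (xs n) (hxs n)]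
    exact hg.2 i q₁ q₂ xs x hxs hx hlim
  · have h := (Measure.ae_prod_iff_ae_ae (μ := volume) (ν := volume) hSm).2 (hg.ae_ae_norm_le j)
    filter_upwards [h] with p hp
    exact indicator_of_mem (show p ∈ S from hp) _
  · dsimp only
    by_cases hp : (t, x) ∈ S
    · rw [indicator_of_mem hp]
      exact hp (hx.trans_lt (lt_add_one _))
    · rw [indicator_of_notMem hp, norm_zero]
      exact ENNReal.toReal_nonneg

/-- If functions with bounds of total mass at most `C` on a rational interval converge to `g`,
then the supremum of `g` over a countable dense set has integral at most `C + η`. -/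
lemma SigmaTendsto.lintegral_ballSup_le [CompleteSpace F] (hg : IsCara g)
    {fs : ℕ → ℝ → Euc N → F} (hfs : ∀ n, IsCara (fs n)) (hlim : SigmaTendsto Θ fs g) (j : ℕ)
    {m : ℕ → ℝ → ℝ} (hm0 : ∀ n t, 0 ≤ m n t) (hm : ∀ n, LocInt (m n))
    (hbd : ∀ n, ∀ᵐ t : ℝ, ∀ x : Euc N, ‖x‖ ≤ ((j + 1 : ℕ) : ℝ) → ‖fs n t x‖ ≤ m n t)
    {a b : ℚ} (hab : a < b) {C η : ℝ} (hη : 0 < η)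
    (hC : ∀ n, ∫ t in Icc (a : ℝ) b, m n t ≤ C) :
    ∫⁻ t in Ico (a : ℝ) b, ballSup g j t ≤ ENNReal.ofReal (C + η) := by
  have hab' : (a : ℝ) < b := by exact_mod_cast hab
  have hpt : ∀ l i : ℕ, ((a + i * ((b - a) / (l + 1)) : ℚ) : ℝ) = partPt a b l i := fun l i => by
    simp [partPt]
  have hev : ∀ l : ℕ, ∃ n, ∀ i ∈ Finset.range (l + 1), ∀ x : Euc N, ‖x‖ ≤ ((j + 1 : ℕ) : ℝ) →
      ‖∫ t in Icc (partPt a b l i) (partPt a b l (i + 1)), (fs n t x - g t x)‖ <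
        η / (l + 1) := fun l => by
    refine (((Finset.range (l + 1)).eventually_all (l := atTop)).2 fun i _ => ?_).exists
    have := hlim (j + 1) (a + i * ((b - a) / (l + 1))) (a + (i + 1 : ℕ) * ((b - a) / (l + 1)))
      (η / (l + 1)) (by positivity)
    rw [hpt, hpt] at this
    filter_upwards [this] with n hn x hx
    exact hn _ (inK_const hx _ _)
  choose n hn using hev
  refine lintegral_iSup_enorm_le hab' (fun k => hg.integrableOn_comp continuousOn_const)
    (fun l i => (∫ t in Icc (partPt a b l i) (partPt a b l (i + 1)), m (n l) t) + η / (l + 1))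
    (fun l i => add_nonneg (integral_nonneg fun t => hm0 _ t) (by positivity))
    (fun l i hi k => ?_) (fun l => ?_)
  · set y := TopologicalSpace.denseSeq (Euc N) k
    have hy : ‖y‖ ≤ ((j + 1 : ℕ) : ℝ) := by push_cast; exact k.2.le
    have h1 := hn l i (Finset.mem_range.2 (Nat.lt_succ_of_le hi)) y hy
    rw [integral_sub ((hfs _).integrableOn_comp continuousOn_const)
      (hg.integrableOn_comp continuousOn_const)] at h1
    have h2 : ‖∫ t in Icc (partPt a b l i) (partPt a b l (i + 1)), fs (n l) t y‖ ≤
        ∫ t in Icc (partPt a b l i) (partPt a b l (i + 1)), m (n l) t := by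
      refine norm_integral_le_of_norm_le (hm _ _ _) (ae_restrict_of_ae ?_)
      filter_upwards [hbd (n l)] with t ht using ht y hy
    rw [norm_sub_rev] at h1
    have h3 := norm_sub_norm_le
      (∫ t in Icc (partPt a b l i) (partPt a b l (i + 1)), g t y)
      (∫ t in Icc (partPt a b l i) (partPt a b l (i + 1)), fs (n l) t y)
    linarith
  · have hsum : ∑ i ∈ Finset.range (l + 1),
        ∫ t in Icc (partPt a b l i) (partPt a b l (i + 1)), m (n l) t =
        ∫ t in Icc (a : ℝ) b, m (n l) t := by
      have := intervalIntegral.sum_integral_adjacent_intervals (f := m (n l)) (μ := volume)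
        (a := partPt a b l) (n := l + 1) fun i _ =>
          ((hm (n l) _ _).mono_set (uIcc_of_le (partPt_mono hab' l i.le_succ)).subset
            ).intervalIntegrable
      rw [partPt_zero, partPt_last, intervalIntegral.integral_of_le hab'.le] at this
      rw [integral_Icc_eq_integral_Ioc, ← this]
      refine Finset.sum_congr rfl fun i _ => ?_
      rw [integral_Icc_eq_integral_Ioc,
        intervalIntegral.integral_of_le (partPt_mono hab' l i.le_succ)]
    rw [Finset.sum_add_distrib, hsum, Finset.sum_const, Finset.card_range, nsmul_eq_mul]
    have : ((l + 1 : ℕ) : ℝ) * (η / (l + 1)) = η := by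
      push_cast
      field_simp
    rw [this]
    linarith [hC (n l)]

end WeakCaratheodory


/-- the σ_Θ-sequential closure of a set `E ⊆ WTC` with
L¹_loc-equicontinuous m-bounds (chosen nondecreasing in `j`) again admits
L¹_loc-equicontinuous m-bounds, jointly with those of `E`. -/
theorem stmt4 {N M : ℕ} (Θ : SuitableModuli) (E : Set (ℝ → Euc N → Euc M))
    (hE : ∀ f ∈ E, IsWTC Θ f)
    (m : (ℝ → Euc N → Euc M) → ℕ → ℝ → ℝ)
    (hm_nonneg : ∀ f ∈ E, ∀ (j : ℕ) (t : ℝ), 0 ≤ m f j t)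
    (hm_int : ∀ f ∈ E, ∀ j : ℕ, LocInt (m f j))
    (hm_bound : ∀ f ∈ E, ∀ j : ℕ, ∀ᵐ t : ℝ, ∀ x : Euc N, ‖x‖ ≤ (j:ℝ) → ‖f t x‖ ≤ m f j t)
    (hm_mono : ∀ f ∈ E, ∀ j : ℕ, ∀ᵐ t : ℝ, m f j t ≤ m f (j+1) t)
    (hm_equi : ∀ j : ℕ, ∀ r > (0:ℝ), ∀ ε > (0:ℝ), ∃ δ > (0:ℝ), ∀ f ∈ E, ∀ s t : ℝ,
      -r ≤ s → s ≤ t → t ≤ r → t - s < δ → ∫ u in Icc s t, m f j u < ε) :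
    ∃ M' : (ℝ → Euc N → Euc M) → ℕ → ℝ → ℝ,
      (∀ g : ℝ → Euc N → Euc M, IsWTC Θ g →
        (∃ fs : ℕ → ℝ → Euc N → Euc M, (∀ n, fs n ∈ E) ∧ SigmaTendsto Θ fs g) →
        ∀ j : ℕ, (∀ t, 0 ≤ M' g j t) ∧ LocInt (M' g j) ∧
          ∃ gstar : ℝ → Euc N → Euc M, IsWTC Θ gstar ∧
            (∀ᵐ p : ℝ × Euc N, gstar p.1 p.2 = g p.1 p.2) ∧
            ∀ᵐ t : ℝ, ∀ x : Euc N, ‖x‖ ≤ (j:ℝ) → ‖gstar t x‖ ≤ M' g j t) ∧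
      (∀ j : ℕ, ∀ r > (0:ℝ), ∀ ε > (0:ℝ), ∃ δ > (0:ℝ),
        (∀ f ∈ E, ∀ s t : ℝ, -r ≤ s → s ≤ t → t ≤ r → t - s < δ →
          ∫ u in Icc s t, m f j u < ε) ∧
        (∀ g : ℝ → Euc N → Euc M, IsWTC Θ g →
          (∃ fs : ℕ → ℝ → Euc N → Euc M, (∀ n, fs n ∈ E) ∧ SigmaTendsto Θ fs g) →
          ∀ s t : ℝ, -r ≤ s → s ≤ t → t ≤ r → t - s < δ →
            ∫ u in Icc s t, M' g j u < ε)) := by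
  refine ⟨fun g j t => (ballSup g j t).toReal, fun g hg _ j => ?_, fun j r hr ε hε => ?_⟩
  · obtain ⟨gstar, h1, h2, h3⟩ := hg.exists_ae_eq_norm_le j
    exact ⟨fun t => ENNReal.toReal_nonneg, hg.1.locInt_ballSup j, gstar, h1, h2,
      Eventually.of_forall h3⟩
  obtain ⟨δ₁, hδ₁, h₁⟩ := hm_equi j r hr ε hε
  obtain ⟨δ₂, hδ₂, h₂⟩ := hm_equi (j + 1) (r + 1) (by positivity) (ε / 2) (half_pos hε)
  refine ⟨min δ₁ δ₂, lt_min hδ₁ hδ₂, fun f hf s t hs hst ht hδ =>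
    h₁ f hf s t hs hst ht (hδ.trans_le (min_le_left _ _)), ?_⟩
  rintro g hg ⟨fs, hfs, hlim⟩ s t hs hst ht hδ
  have hδ' : t - s < δ₂ := hδ.trans_le (min_le_right _ _)
  set η : ℝ := min 1 ((δ₂ - (t - s)) / 2) with hη
  have hη0 : 0 < η := lt_min one_pos (by linarith)
  have hη1 : η ≤ 1 := min_le_left _ _
  have hη2 : η ≤ (δ₂ - (t - s)) / 2 := min_le_right _ _
  obtain ⟨a, has, hsa⟩ := exists_rat_btwn (sub_lt_self s hη0)
  obtain ⟨b, htb, hbt⟩ := exists_rat_btwn (lt_add_of_pos_right t hη0)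
  have hab : a < b := by
    have : (a : ℝ) < b := by linarith
    exact_mod_cast this
  have hle := SigmaTendsto.lintegral_ballSup_le hg.1 (fun n => (hE _ (hfs n)).1) hlim j
    (m := fun n => m (fs n) (j + 1)) (fun n => hm_nonneg _ (hfs n) _) (fun n => hm_int _ (hfs n) _)
    (fun n => hm_bound _ (hfs n) _) hab (C := ε / 2) (η := ε / 4) (by positivity)
    (fun n => (h₂ _ (hfs n) a b (by linarith) (by exact_mod_cast hab.le) (by linarith)
      (by linarith)).le)
  rw [integral_toReal (hg.1.measurable_ballSup j).aemeasurable
    (ae_restrict_of_ae (hg.1.ae_ballSup_lt_top j))]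
  refine lt_of_le_of_lt (ENNReal.toReal_le_of_le_ofReal (by positivity)
    ((lintegral_mono_set fun u hu => ?_).trans hle)) (by linarith : ε / 2 + ε / 4 < ε)
  exact ⟨hsa.le.trans hu.1, hu.2.trans_lt htb⟩
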